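/- Let X be a Banach space and T : X → X a continuous compact map (T maps bounded sets to relatively compact sets). If the set {x ∈ X : ∃ ρ ∈ [0,1], x = ρ • T x} is bounded, then T has a fixed point. -/

import Mathlib

theorem scarf_pq {α β : Type*} [DecidableEq α] [DecidableEq β] (s : Finset α) (f : α → β)
    (h : (s.image f).card + 1 = s.card) :
    ∃ p ∈ s, ∃ q ∈ s, p ≠ q ∧ f p = f q ∧
      ∀ i ∈ s, ∀ j ∈ s, f i = f j → i = j ∨ (i = p ∧ j = q) ∨ (i = q ∧ j = p) := by
  have hni : ¬ Set.InjOn f s := by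
    intro hi
    have := Finset.card_image_of_injOn hi
    omega
  have : ∃ p ∈ s, ∃ q ∈ s, f p = f q ∧ p ≠ q := by
    by_contra hc
    push Not at hc
    exact hni fun p hp q hq h => hc p hp q hq h
  obtain ⟨p, hp, q, hq, hpq, hne⟩ := this
  have him : (s.erase q).image f = s.image f := by
    ext b
    simp only [Finset.mem_image, Finset.mem_erase]
    constructor
    · rintro ⟨x, hx, rfl⟩
      exact ⟨x, hx.2, rfl⟩
    · rintro ⟨x, hx, rfl⟩
      by_cases hxq : x = q
      · exact ⟨p, ⟨hne, hp⟩, by rw [hpq, hxq]⟩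
      · exact ⟨x, ⟨hxq, hx⟩, rfl⟩
  have hinj : Set.InjOn f (s.erase q : Finset α) := by
    rw [← Finset.card_image_iff, him, Finset.card_erase_of_mem hq]
    omega
  have hinj' : ∀ i ∈ s, i ≠ q → ∀ j ∈ s, j ≠ q → f i = f j → i = j := by
    intro i hi hiq j hj hjq hij
    exact hinj (by simp [hi, hiq]) (by simp [hj, hjq]) hij
  refine ⟨p, hp, q, hq, hne, hpq, ?_⟩
  intro i hi j hj hij
  by_cases hiq : i = q
  · by_cases hjq : j = q
    · left; rw [hiq, hjq]
    · right; right
      refine ⟨hiq, hinj' j hj hjq p hp hne ?_⟩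
      rw [← hij, hiq, hpq]
  · by_cases hjq : j = q
    · right; left
      refine ⟨hinj' i hi hiq p hp hne ?_, hjq⟩
      rw [hij, hjq, hpq]
    · left; exact hinj' i hi hiq j hj hjq hij

def ScarfDom {I V : Type*} (u : I → V → ℕ) (S : Finset V) : Prop :=
  ∀ v, ∃ i, ∀ s ∈ S, u i v ≤ u i s

def ScarfA {I V : Type*} (u : I → V → ℕ) (m : I → V) (p : I) (v : V) : Prop :=
  ∀ j, j ≠ p → u j (m j) < u j v

theorem scarf_door {I V : Type*} [Fintype I] [DecidableEq I] [Fintype V] [DecidableEq V]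
    (u : I → V → ℕ) (hu : ∀ i, Function.Injective (u i)) (τ : Finset V)
    (hτ : τ.card + 1 = Fintype.card I) (hne : τ.Nonempty) (hD : ScarfDom u τ) :
    ∃ (m : I → V) (p q : I), (∀ i, m i ∈ τ) ∧ (∀ i, ∀ s ∈ τ, u i (m i) ≤ u i s) ∧ p ≠ q ∧
      m p = m q ∧
      (∀ y, (y ∉ τ ∧ ScarfDom u (insert y τ)) ↔
        ((ScarfA u m p y ∧ ∀ v, ScarfA u m p v → u p v ≤ u p y) ∨
         (ScarfA u m q y ∧ ∀ v, ScarfA u m q v → u q v ≤ u q y))) ∧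
      (∀ y, ScarfA u m p y → ¬ ScarfA u m q y) := by
  have hm : ∀ i, ∃ x ∈ τ, ∀ s ∈ τ, u i x ≤ u i s := fun i => Finset.exists_min_image τ (u i) hne
  choose m hmτ hmin using hm
  have huniq : ∀ i, ∀ s ∈ τ, (∀ s' ∈ τ, u i s ≤ u i s') → s = m i := by
    intro i s hs h
    exact hu i (le_antisymm (h _ (hmτ i)) (hmin i s hs))
  have him : Finset.univ.image m = τ := by
    ext s
    simp only [Finset.mem_image, Finset.mem_univ, true_and]
    constructor
    · rintro ⟨i, rfl⟩; exact hmτ i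
    · intro hs
      obtain ⟨i, hi⟩ := hD s
      exact ⟨i, (huniq i s hs hi).symm⟩
  obtain ⟨p, -, q, -, hpq, hmpq, hcol⟩ := scarf_pq Finset.univ m (by rw [him, hτ, Finset.card_univ])
  -- backwards direction, for either index
  have back : ∀ p q : I, p ≠ q → m p = m q → ∀ y, ScarfA u m p y →
      (∀ v, ScarfA u m p v → u p v ≤ u p y) → y ∉ τ ∧ ScarfDom u (insert y τ) := by
    intro p q hpq hmpq y hA hmax
    constructor
    · intro hy
      obtain ⟨k, hk⟩ := hD y
      have hyk := huniq k y hy hk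
      by_cases hkp : k = p
      · have := hA q hpq.symm
        rw [hyk, hkp, hmpq] at this
        exact lt_irrefl _ this
      · have := hA k hkp
        rw [← hyk] at this
        exact lt_irrefl _ this
    · intro v
      by_cases hv : ScarfA u m p v
      · obtain ⟨k, hk⟩ := hD v
        have hkp : k = p := by
          by_contra hkp
          have := hv k hkp
          have := hk _ (hmτ k)
          omega
        subst hkp
        refine ⟨k, ?_⟩
        intro s hs
        rcases Finset.mem_insert.1 hs with rfl | hs
        · exact hmax v hv
        · exact hk s hs
      · unfold ScarfA at hv
        push Not at hv
        obtain ⟨j, hjp, hj⟩ := hv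
        refine ⟨j, ?_⟩
        intro s hs
        rcases Finset.mem_insert.1 hs with rfl | hs
        · exact hj.trans (hA j hjp).le
        · exact hj.trans (hmin j s hs)
  refine ⟨m, p, q, hmτ, hmin, hpq, hmpq, ?_, ?_⟩
  · intro y
    constructor
    · rintro ⟨hy, hDy⟩
      choose g hg using hDy
      have hginj : Set.InjOn g (insert y τ : Finset V) := by
        intro s hs t ht hst
        apply hu (g s)
        apply le_antisymm (hg s t ht)
        rw [hst]
        exact hg t s hs
      have hgim : (insert y τ).image g = Finset.univ := by
        apply Finset.eq_univ_of_card
        rw [Finset.card_image_of_injOn hginj, Finset.card_insert_of_notMem hy, hτ]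
      have hA : ScarfA u m (g y) y := by
        intro j hj
        have : j ∈ (insert y τ).image g := by rw [hgim]; exact Finset.mem_univ _
        obtain ⟨s, hs, rfl⟩ := Finset.mem_image.1 this
        have hsy : s ≠ y := fun h => hj (by rw [h])
        have hsτ : s ∈ τ := (Finset.mem_insert.1 hs).resolve_left hsy
        have h1 : s = m (g s) := huniq _ s hsτ fun s' hs' => hg s s' (Finset.mem_insert_of_mem hs')
        rw [← h1]
        exact lt_of_le_of_ne (hg s y (Finset.mem_insert_self _ _)) fun h => hsy (hu _ h)
      have hmax : ∀ v, ScarfA u m (g y) v → u (g y) v ≤ u (g y) y := by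
        intro v hv
        have h1 := hg v
        by_cases hk : g v = g y
        · rw [← hk]; exact h1 y (Finset.mem_insert_self _ _)
        · have := hv _ hk
          have := h1 _ (Finset.mem_insert_of_mem (hmτ (g v)))
          omega
      have hi : g y = p ∨ g y = q := by
        have hs := hmτ (g y)
        have h1 : m (g y) = m (g (m (g y))) :=
          huniq _ _ hs fun s' hs' => hg _ s' (Finset.mem_insert_of_mem hs')
        rcases hcol _ (Finset.mem_univ _) _ (Finset.mem_univ _) h1 with h | h | h
        · exfalso
          have := hginj (Finset.mem_insert_self _ _) (Finset.mem_insert_of_mem hs) h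
          exact hy (this ▸ hs)
        · exact Or.inl h.1
        · exact Or.inr h.1
      rcases hi with h | h
      · left; rw [h] at hA hmax; exact ⟨hA, hmax⟩
      · right; rw [h] at hA hmax; exact ⟨hA, hmax⟩
    · rintro (⟨h1, h2⟩ | ⟨h1, h2⟩)
      · exact back p q hpq hmpq y h1 h2
      · exact back q p hpq.symm hmpq.symm y h1 h2
  · intro y hp hq
    obtain ⟨k, hk⟩ := hD y
    have h1 := hk _ (hmτ k)
    by_cases hkp : k = p
    · have := hq k (by rw [hkp]; exact hpq)
      omega
    · have := hp k hkp
      omega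

theorem scarf_max {I V : Type*} [Fintype V] (u : I → V → ℕ) (m : I → V) (p : I)
    (h : ∃ v, ScarfA u m p v) : ∃ y, ScarfA u m p y ∧ ∀ v, ScarfA u m p v → u p v ≤ u p y := by
  classical
  obtain ⟨v, hv⟩ := h
  obtain ⟨y, hy, hm⟩ := Finset.exists_max_image (Finset.univ.filter (ScarfA u m p)) (u p)
    ⟨v, by simpa using hv⟩
  exact ⟨y, by simpa using hy, fun v hv => hm v (by simpa using hv)⟩

open Classical in
theorem scarf_main {I V : Type*} [Fintype I] [Nontrivial I] [Fintype V]
    (u : I → V → ℕ) (hu : ∀ i, Function.Injective (u i)) (e : I → V) (c : V → I)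
    (hce : ∀ i, c (e i) = i)
    (he : ∀ i v, v ≠ e i → u i (e i) < u i v)
    (htop : ∀ i j v, j ≠ i → (∀ k, v ≠ e k) → u i v < u i (e j))
    (x0 : V) (hx0 : ∀ k, x0 ≠ e k) :
    ∃ S : Finset V, ScarfDom u S ∧ S.card = Fintype.card I ∧ ∀ i, ∃ s ∈ S, c s = i := by
  by_contra hno
  have hcardI : 2 ≤ Fintype.card I := Fintype.one_lt_card
  obtain ⟨a, -⟩ := exists_pair_ne I
  have hcarderase : ((Finset.univ : Finset I).erase a).card + 1 = Fintype.card I := by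
    rw [Finset.card_erase_of_mem (Finset.mem_univ _), Finset.card_univ]; omega
  have heinj : Function.Injective e := fun i j h => by rw [← hce i, h, hce]
  obtain ⟨P, hP⟩ : ∃ P : Finset V → V → Prop, ∀ S x, P S x ↔
      (x ∈ S ∧ ScarfDom u S ∧ S.card = Fintype.card I ∧
        (S.erase x).image c = Finset.univ.erase a) := ⟨_, fun _ _ => Iff.rfl⟩
  obtain ⟨Q, hQ⟩ : ∃ Q : Finset V → V → Prop, ∀ τ y, Q τ y ↔
      (y ∉ τ ∧ ScarfDom u (insert y τ) ∧ τ.card + 1 = Fintype.card I ∧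
        τ.image c = Finset.univ.erase a) := ⟨_, fun _ _ => Iff.rfl⟩
  have hPQ : (Finset.univ.filter fun z : Finset V × V => P z.1 z.2).card =
      (Finset.univ.filter fun z : Finset V × V => Q z.1 z.2).card := by
    refine Finset.card_nbij' (fun z => (z.1.erase z.2, z.2)) (fun z => (insert z.2 z.1, z.2))
      ?_ ?_ ?_ ?_
    · rintro ⟨S, x⟩ h
      simp only [hP, hQ, Finset.coe_filter, Finset.mem_univ, true_and, Set.mem_ofPred_eq] at h ⊢
      obtain ⟨h1, h2, h3, h4⟩ := h
      refine ⟨Finset.notMem_erase _ _, by rwa [Finset.insert_erase h1], ?_, h4⟩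
      rw [Finset.card_erase_of_mem h1]; omega
    · rintro ⟨S, x⟩ h
      simp only [hP, hQ, Finset.coe_filter, Finset.mem_univ, true_and, Set.mem_ofPred_eq] at h ⊢
      obtain ⟨h1, h2, h3, h4⟩ := h
      refine ⟨Finset.mem_insert_self _ _, h2, ?_, by rwa [Finset.erase_insert h1]⟩
      rw [Finset.card_insert_of_notMem h1]; omega
    · rintro ⟨S, x⟩ h
      simp only [hP, Finset.coe_filter, Finset.mem_univ, true_and, Set.mem_ofPred_eq] at h
      simp [Finset.insert_erase h.1]
    · rintro ⟨S, x⟩ h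
      simp only [hQ, Finset.coe_filter, Finset.mem_univ, true_and, Set.mem_ofPred_eq] at h
      simp [Finset.erase_insert h.1]
  have hsum : ∀ R : Finset V → V → Prop,
      (Finset.univ.filter fun z : Finset V × V => R z.1 z.2).card =
        ∑ S : Finset V, (Finset.univ.filter (R S)).card := by
    intro R
    rw [Finset.card_filter, Fintype.sum_prod_type]
    simp only [Finset.card_filter]
  rw [hsum P, hsum Q] at hPQ
  have hPeven : Even (∑ S : Finset V, (Finset.univ.filter (P S)).card) := by
    apply Finset.even_sum
    intro S _
    by_cases hex : ∃ x, P S x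
    · obtain ⟨x, hPx⟩ := hex
      obtain ⟨hx, hD, hc, him⟩ := (hP _ _).1 hPx
      have hsub : Finset.univ.erase a ⊆ S.image c := by
        rw [← him]; exact Finset.image_subset_image (Finset.erase_subset _ _)
      have ha : a ∉ S.image c := by
        intro ha
        apply hno
        refine ⟨S, hD, hc, fun i => ?_⟩
        have : i ∈ S.image c := by
          by_cases hia : i = a
          · rw [hia]; exact ha
          · exact hsub (by simp [hia])
        simpa using this
      have himS : S.image c = Finset.univ.erase a := by
        apply Finset.Subset.antisymm _ hsub
        intro i hi
        simp only [Finset.mem_erase, Finset.mem_univ, and_true]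
        rintro rfl
        exact ha hi
      obtain ⟨p, hp, q, hq, hpq, hcpq, hcol⟩ := scarf_pq S c (by rw [himS, hcarderase, hc])
      have key : ∀ p q, p ∈ S → q ∈ S → p ≠ q → c p = c q → P S p := by
        intro p q hp hq hpq hcpq
        refine (hP _ _).2 ⟨hp, hD, hc, ?_⟩
        rw [← himS]
        ext b
        simp only [Finset.mem_image, Finset.mem_erase]
        constructor
        · rintro ⟨x, hx, rfl⟩
          exact ⟨x, hx.2, rfl⟩
        · rintro ⟨x, hx, rfl⟩
          by_cases hxq : x = p
          · exact ⟨q, ⟨hpq.symm, hq⟩, by rw [← hcpq, hxq]⟩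
          · exact ⟨x, ⟨hxq, hx⟩, rfl⟩
      have : Finset.univ.filter (P S) = {p, q} := by
        ext y
        simp only [Finset.mem_filter, Finset.mem_univ, true_and, Finset.mem_insert,
          Finset.mem_singleton]
        constructor
        · intro hPy
          obtain ⟨hy, -, -, hy4⟩ := (hP _ _).1 hPy
          have : c y ∈ (S.erase y).image c := by
            rw [hy4, ← himS]; exact Finset.mem_image_of_mem _ hy
          obtain ⟨z, hz, hzy⟩ := Finset.mem_image.1 this
          rw [Finset.mem_erase] at hz
          rcases hcol z hz.2 y hy hzy with h | h | h
          · exact absurd h hz.1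
          · exact Or.inr h.2
          · exact Or.inl h.2
        · rintro (rfl | rfl)
          · exact key _ _ hp hq hpq hcpq
          · exact key _ _ hq hp hpq.symm hcpq.symm
      rw [this, Finset.card_pair hpq]
      exact even_two
    · push Not at hex
      rw [Finset.filter_false_of_mem (fun x _ => hex x)]
      simp
  -- doors
  have hτne : ∀ τ : Finset V, τ.card + 1 = Fintype.card I → τ.Nonempty := by
    intro τ h
    rw [← Finset.card_pos]; omega
  set τ0 : Finset V := (Finset.univ.erase a).image e with hτ0
  have hQeven : ∀ τ, τ ≠ τ0 → Even (Finset.univ.filter (Q τ)).card := by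
    intro τ hττ
    by_cases hex : ∃ x, Q τ x
    · obtain ⟨x, hQx⟩ := hex
      obtain ⟨hx, hD', hc, him⟩ := (hQ _ _).1 hQx
      have hD : ScarfDom u τ := fun v => by
        obtain ⟨i, hi⟩ := hD' v
        exact ⟨i, fun s hs => hi s (Finset.mem_insert_of_mem hs)⟩
      obtain ⟨m, p, q, hmτ, hmin, hpq, hmpq, hiff, hdisj⟩ :=
        scarf_door u hu τ hc (hτne τ hc) hD
      have hout : ∃ t ∈ τ, ∀ k, t ≠ e k := by
        by_contra hcon
        push Not at hcon
        apply hττ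
        have hte : ∀ t ∈ τ, t = e (c t) := by
          intro t ht
          obtain ⟨k, hk⟩ := hcon t ht
          rw [hk, hce]
        rw [hτ0, ← him]
        ext v
        simp only [Finset.mem_image]
        constructor
        · intro hv
          exact ⟨c v, ⟨v, hv, rfl⟩, (hte v hv).symm⟩
        · rintro ⟨i, ⟨w, hw, rfl⟩, rfl⟩
          rw [← hte w hw]; exact hw
      obtain ⟨t, ht, hte⟩ := hout
      have hA : ∀ p, ScarfA u m p (e p) := by
        intro p j hj
        exact lt_of_le_of_lt (hmin j t ht) (htop j p t hj.symm hte)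
      obtain ⟨y, hy, hymax⟩ := scarf_max u m p ⟨_, hA p⟩
      obtain ⟨z, hz, hzmax⟩ := scarf_max u m q ⟨_, hA q⟩
      have : Finset.univ.filter (Q τ) = {y, z} := by
        ext w
        simp only [Finset.mem_filter, Finset.mem_univ, true_and, Finset.mem_insert,
          Finset.mem_singleton]
        have : Q τ w ↔ (w ∉ τ ∧ ScarfDom u (insert w τ)) := by
          rw [hQ]; tauto
        rw [this, hiff]
        constructor
        · rintro (⟨h1, h2⟩ | ⟨h1, h2⟩)
          · left; exact hu p (le_antisymm (hymax _ h1) (h2 _ hy))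
          · right; exact hu q (le_antisymm (hzmax _ h1) (h2 _ hz))
        · rintro (rfl | rfl)
          · exact Or.inl ⟨hy, hymax⟩
          · exact Or.inr ⟨hz, hzmax⟩
      rw [this, Finset.card_pair]
      · exact even_two
      · rintro rfl
        exact hdisj _ hy hz
    · push Not at hex
      rw [Finset.filter_false_of_mem (fun x _ => hex x)]
      simp
  have hQ1 : (Finset.univ.filter (Q τ0)).card = 1 := by
    have hc : τ0.card + 1 = Fintype.card I := by
      rw [hτ0, Finset.card_image_of_injective _ heinj, hcarderase]
    have him : τ0.image c = Finset.univ.erase a := by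
      rw [hτ0, Finset.image_image]
      have : c ∘ e = id := funext hce
      rw [this, Finset.image_id]
    have hmem : ∀ j, j ≠ a → e j ∈ τ0 := fun j hj =>
      Finset.mem_image_of_mem _ (by simp [hj])
    have hD : ScarfDom u τ0 := by
      intro v
      by_cases hv : ∃ k, v = e k
      · obtain ⟨k, rfl⟩ := hv
        refine ⟨k, fun s _ => ?_⟩
        by_cases hs : s = e k
        · rw [hs]
        · exact (he k s hs).le
      · push Not at hv
        refine ⟨a, fun s hs => ?_⟩
        obtain ⟨j, hj, rfl⟩ := Finset.mem_image.1 hs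
        exact (htop a j v (Finset.ne_of_mem_erase hj) hv).le
    obtain ⟨m, p, q, hmτ, hmin, hpq, hmpq, hiff, hdisj⟩ :=
        scarf_door u hu τ0 hc (hτne τ0 hc) hD
    have hme : ∀ j, j ≠ a → m j = e j := by
      intro j hj
      by_contra hne
      have h1 := he j _ hne
      have h2 := hmin j _ (hmem j hj)
      omega
    have hAa : ScarfA u m a x0 := by
      intro j hj
      rw [hme j hj]
      exact he j _ (hx0 j)
    have hAq : ∀ q, q ≠ a → m a = m q → ∀ v, ¬ ScarfA u m q v := by
      intro q hqa hmaq v hv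
      have h1 := hv a hqa.symm
      rw [hmaq, hme q hqa] at h1
      by_cases hvk : ∃ k, v = e k
      · obtain ⟨k, rfl⟩ := hvk
        by_cases hka : k = a
        · subst hka
          have := he k (e q) (fun h => hqa (heinj h))
          omega
        · by_cases hkq : k = q
          · rw [hkq] at h1; exact lt_irrefl _ h1
          · have := hv k hkq
            rw [hme k hka] at this
            exact lt_irrefl _ this
      · push Not at hvk
        have := htop a q v hqa hvk
        omega
    obtain ⟨y, hy, hymax⟩ := scarf_max u m a ⟨_, hAa⟩
    have hfin : ∀ w, (w ∉ τ0 ∧ ScarfDom u (insert w τ0)) ↔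
        (ScarfA u m a w ∧ ∀ v, ScarfA u m a v → u a v ≤ u a w) := by
      intro w
      rw [hiff]
      by_cases hpa : p = a
      · subst hpa
        have := hAq q hpq.symm hmpq w
        tauto
      · by_cases hqa : q = a
        · subst hqa
          have := hAq p hpa hmpq.symm w
          tauto
        · rw [hme p hpa, hme q hqa] at hmpq
          exact absurd (heinj hmpq) hpq
    rw [Finset.card_eq_one]
    refine ⟨y, ?_⟩
    ext w
    simp only [Finset.mem_filter, Finset.mem_univ, true_and, Finset.mem_singleton]
    have : Q τ0 w ↔ (w ∉ τ0 ∧ ScarfDom u (insert w τ0)) := by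
      rw [hQ]; tauto
    rw [this, hfin]
    constructor
    · rintro ⟨h1, h2⟩
      exact hu a (le_antisymm (hymax _ h1) (h2 _ hy))
    · rintro rfl
      exact ⟨hy, hymax⟩
  rw [hPQ, ← Finset.add_sum_erase _ _ (Finset.mem_univ τ0), hQ1] at hPeven
  have h2 : Even (∑ τ ∈ Finset.univ.erase τ0, (Finset.univ.filter (Q τ)).card) :=
    Finset.even_sum _ fun τ hτ => hQeven τ (Finset.ne_of_mem_erase hτ)
  rw [Nat.even_add] at hPeven
  exact Nat.not_even_one (hPeven.2 h2)

theorem scarf_grid {I : Type*} [Fintype I] [Nontrivial I] (N : ℕ)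
    (c0 : (I → ℕ) → I) :
    ∃ k0 : I → ℕ, ∑ i, k0 i = N ∧ ∀ i, ∃ k : I → ℕ, ∑ i, k i = N ∧
      (∀ j, k j ≤ k0 j + Fintype.card I ∧ k0 j ≤ k j + Fintype.card I) ∧
      (c0 k = i ∨ k i ≤ Fintype.card I) := by
  classical
  let X := {k : I → Fin (N + 1) // ∑ i, (k i : ℕ) = N}
  have mkX : ∀ k : I → ℕ, ∑ i, k i = N → ∃ x : X, ∀ i, (x.1 i : ℕ) = k i := by
    intro k hk
    refine ⟨⟨fun i => ⟨k i, ?_⟩, by simpa using hk⟩, fun i => rfl⟩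
    have := Finset.single_le_sum (f := k) (fun _ _ => Nat.zero_le _) (Finset.mem_univ i)
    omega
  obtain ⟨i0, -⟩ := exists_pair_ne I
  obtain ⟨x0, -⟩ := mkX (Pi.single i0 N) (by simp)
  let M := Fintype.card X
  let idx : X ≃ Fin M := Fintype.equivFin X
  let idI : I ≃ Fin (Fintype.card I) := Fintype.equivFin I
  let u : I → X ⊕ I → ℕ := fun i v => match v with
    | Sum.inl x => M * (x.1 i : ℕ) + (idx x : ℕ) + 1
    | Sum.inr j => if j = i then 0 else M * (N + 1) + 1 + (idI j : ℕ)
  have ul : ∀ i x, u i (Sum.inl x) = M * (x.1 i : ℕ) + (idx x : ℕ) + 1 := fun _ _ => rfl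
  have ur : ∀ i, u i (Sum.inr i) = 0 := fun i => if_pos rfl
  have ur' : ∀ i j, j ≠ i → u i (Sum.inr j) = M * (N + 1) + 1 + (idI j : ℕ) :=
    fun i j h => if_neg h
  have hlt : ∀ i x, u i (Sum.inl x) < M * (N + 1) + 1 := by
    intro i x
    rw [ul]
    have h1 : M * (x.1 i : ℕ) ≤ M * N := Nat.mul_le_mul_left _ (by have := (x.1 i).2; omega)
    have h2 := (idx x).2
    rw [Nat.mul_add]
    omega
  have hu : ∀ i, Function.Injective (u i) := by
    intro i v w h
    rcases v with x | j <;> rcases w with y | k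
    · rw [ul, ul] at h
      have h1 : (idx x : ℕ) = idx y := by
        have h3 : (M * (x.1 i : ℕ) + (idx x : ℕ)) % M = (M * (y.1 i : ℕ) + (idx y : ℕ)) % M := by
          congr 1; omega
        rwa [Nat.mul_add_mod, Nat.mul_add_mod, Nat.mod_eq_of_lt (idx x).2,
          Nat.mod_eq_of_lt (idx y).2] at h3
      rw [idx.injective (Fin.ext h1)]
    · exfalso
      have h1 := hlt i x
      by_cases hk : k = i
      · rw [hk, ur, ul] at h; omega
      · rw [ur' _ _ hk] at h; omega
    · exfalso
      have h1 := hlt i y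
      by_cases hk : j = i
      · rw [hk, ur, ul] at h; omega
      · rw [ur' _ _ hk] at h; omega
    · by_cases hj : j = i <;> by_cases hk : k = i
      · rw [hj, hk]
      · rw [hj, ur, ur' _ _ hk] at h; omega
      · rw [hk, ur, ur' _ _ hj] at h; omega
      · rw [ur' _ _ hj, ur' _ _ hk] at h
        rw [idI.injective (Fin.ext (by omega : (idI j : ℕ) = idI k))]
  let c : X ⊕ I → I := fun v => match v with
    | Sum.inl x => c0 (fun i => (x.1 i : ℕ))
    | Sum.inr j => j
  obtain ⟨S, hD, -, hrain⟩ := scarf_main u hu Sum.inr c (fun _ => rfl)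
    (by
      intro i v hv
      rcases v with x | j
      · rw [ur, ul]; omega
      · have : j ≠ i := fun h => hv (by rw [h])
        rw [ur, ur' _ _ this]; omega)
    (by
      intro i j v hj hv
      rcases v with x | k
      · rw [ur' _ _ hj]; have := hlt i x; omega
      · exact absurd rfl (hv k))
    (Sum.inl x0) (fun k => Sum.inl_ne_inr)
  have hDom : ∀ x : X, ∃ i, Sum.inr i ∉ S ∧ ∀ s ∈ S, u i (Sum.inl x) ≤ u i s := by
    intro x
    obtain ⟨i, hi⟩ := hD (Sum.inl x)
    refine ⟨i, fun h => ?_, hi⟩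
    have := hi _ h
    rw [ur, ul] at this
    omega
  have hJ : ∀ j, Sum.inr j ∉ S → ∃ x : X, Sum.inl x ∈ S ∧ c0 (fun i => (x.1 i : ℕ)) = j := by
    intro j hj
    obtain ⟨s, hs, hc⟩ := hrain j
    rcases s with x | k
    · exact ⟨x, hs, hc⟩
    · exact absurd (show Sum.inr j ∈ S from (show k = j from hc) ▸ hs) hj
  obtain ⟨j0, hj0, -⟩ := hDom x0
  obtain ⟨s0, hs0, -⟩ := hJ j0 hj0
  have hm : ∀ j : I, ∃ x : X, Sum.inl x ∈ S ∧ ∀ y : X, Sum.inl y ∈ S →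
      (x.1 j : ℕ) ≤ (y.1 j : ℕ) := by
    intro j
    obtain ⟨x, hx, hmin⟩ := Finset.exists_min_image
      (Finset.univ.filter fun x : X => Sum.inl x ∈ S) (fun x => (x.1 j : ℕ)) ⟨s0, by simpa using hs0⟩
    exact ⟨x, by simpa using hx, fun y hy => hmin y (by simpa using hy)⟩
  choose mx hmxS hmin using hm
  let mm : I → ℕ := fun j => if Sum.inr j ∈ S then 0 else ((mx j).1 j : ℕ)
  have hbig : N < ∑ j, mm j + Fintype.card I := by
    by_contra hcon
    let g : I → ℕ := fun j => if Sum.inr j ∈ S then 0 else ((mx j).1 j : ℕ) + 1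
    have hg : ∑ j, g j ≤ N := by
      have : ∑ j, g j ≤ ∑ j, (mm j + 1) := by
        apply Finset.sum_le_sum
        intro j _
        simp only [g, mm]
        split_ifs <;> omega
      rw [Finset.sum_add_distrib] at this
      simp at this
      omega
    obtain ⟨x, hx⟩ := mkX (fun j => g j + (Pi.single j0 (N - ∑ j, g j) : I → ℕ) j) (by
      rw [Finset.sum_add_distrib]
      simp
      omega)
    obtain ⟨i, hi, hle⟩ := hDom x
    have h1 := hle _ (hmxS i)
    rw [ul, ul] at h1
    have h2 : ((mx i).1 i : ℕ) + 1 ≤ (x.1 i : ℕ) := by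
      rw [hx i]
      simp only [g, if_neg hi]
      omega
    have h3 := Nat.mul_le_mul_left M h2
    have h4 := (idx (mx i)).2
    rw [Nat.mul_add] at h3
    omega
  have hlow : ∀ x : X, Sum.inl x ∈ S → ∀ j, mm j ≤ (x.1 j : ℕ) := by
    intro x hx j
    simp only [mm]
    split_ifs
    · omega
    · exact hmin j x hx
  have hup : ∀ x : X, Sum.inl x ∈ S → ∀ j, (x.1 j : ℕ) ≤ mm j + Fintype.card I := by
    intro x hx j
    have h1 := x.2
    rw [← Finset.add_sum_erase _ _ (Finset.mem_univ j)] at h1 hbig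
    have h2 : ∑ i ∈ Finset.univ.erase j, mm i ≤ ∑ i ∈ Finset.univ.erase j, (x.1 i : ℕ) :=
      Finset.sum_le_sum fun i _ => hlow x hx i
    omega
  refine ⟨fun i => (s0.1 i : ℕ), s0.2, fun i => ?_⟩
  by_cases hi : Sum.inr i ∈ S
  · refine ⟨fun i => (s0.1 i : ℕ), s0.2, fun j => ⟨by omega, by omega⟩, Or.inr ?_⟩
    have := hup s0 hs0 i
    simp only [mm, if_pos hi] at this
    dsimp only
    omega
  · obtain ⟨x, hx, hc⟩ := hJ i hi
    refine ⟨fun i => (x.1 i : ℕ), x.2, fun j => ?_, Or.inl hc⟩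
    have h1 := hup s0 hs0 j
    have h2 := hup x hx j
    have h3 := hlow s0 hs0 j
    have h4 := hlow x hx j
    constructor <;> dsimp only <;> omega

open Filter Topology in
theorem brouwer_simplex {I : Type*} [Fintype I] [Nonempty I] (f : (I → ℝ) → (I → ℝ))
    (hf : ContinuousOn f (stdSimplex ℝ I)) (hmaps : Set.MapsTo f (stdSimplex ℝ I) (stdSimplex ℝ I)) :
    ∃ x ∈ stdSimplex ℝ I, f x = x := by
  classical
  suffices h : ∃ x ∈ stdSimplex ℝ I, ∀ i, x i ≤ f x i by
    obtain ⟨x, hx, hle⟩ := h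
    refine ⟨x, hx, ?_⟩
    have h1 : ∑ i, x i = ∑ i, f x i := by rw [hx.2, (hmaps hx).2]
    have h2 := (Finset.sum_eq_sum_iff_of_le (fun i _ => hle i)).1 h1
    exact funext fun i => (h2 i (Finset.mem_univ _)).symm
  rcases subsingleton_or_nontrivial I with hI | hI
  · obtain ⟨i⟩ := ‹Nonempty I›
    refine ⟨Pi.single i 1, single_mem_stdSimplex ℝ i, fun j => ?_⟩
    have h1 := (hmaps (single_mem_stdSimplex ℝ i)).2
    rw [Fintype.sum_subsingleton _ j] at h1
    rw [h1, Subsingleton.elim j i]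
    simp
  have hmem : ∀ (N : ℕ) (k : I → ℕ), ∑ i, k i = N + 1 →
      (fun i => (k i : ℝ) / (N + 1 : ℝ)) ∈ stdSimplex ℝ I := by
    intro N k hk
    refine ⟨fun i => by positivity, ?_⟩
    rw [← Finset.sum_div, div_eq_one_iff_eq (by positivity)]
    exact_mod_cast hk
  have hlab : ∀ x ∈ stdSimplex ℝ I, ∃ i, x i ≤ f x i := by
    intro x hx
    by_contra hcon
    push Not at hcon
    have := Finset.sum_lt_sum_of_nonempty (s := Finset.univ) Finset.univ_nonempty
      (fun i _ => hcon i)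
    rw [hx.2, (hmaps hx).2] at this
    exact lt_irrefl _ this
  have hlab' : ∀ (N : ℕ) (k : I → ℕ), ∃ i, ∑ i, k i = N + 1 →
      (k i : ℝ) / (N + 1 : ℝ) ≤ f (fun i => (k i : ℝ) / (N + 1 : ℝ)) i := by
    intro N k
    by_cases hk : ∑ i, k i = N + 1
    · obtain ⟨i, hi⟩ := hlab _ (hmem N k hk)
      exact ⟨i, fun _ => hi⟩
    · exact ⟨Classical.arbitrary I, fun h => absurd h hk⟩
  choose c hc using hlab'
  choose k0 hk0 k hk hclose hor using fun N => scarf_grid (I := I) (N + 1) (c N)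
  let x : ℕ → I → ℝ := fun N i => (k0 N i : ℝ) / (N + 1 : ℝ)
  let y : I → ℕ → I → ℝ := fun l N i => (k N l i : ℝ) / (N + 1 : ℝ)
  have hx : ∀ N, x N ∈ stdSimplex ℝ I := fun N => hmem N _ (hk0 N)
  have hy : ∀ l N, y l N ∈ stdSimplex ℝ I := fun l N => hmem N _ (hk N l)
  obtain ⟨a, ha, φ, hφ, hlim⟩ := (isCompact_stdSimplex ℝ I).tendsto_subseq hx
  have hδ : Tendsto (fun N : ℕ => (Fintype.card I : ℝ) / (N + 1 : ℝ)) atTop (𝓝 0) :=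
    tendsto_const_div_atTop_nhds_zero_nat (Fintype.card I : ℝ) |>.comp (tendsto_add_atTop_nat 1) |>.congr
      (fun n => by simp)
  have hδφ := hδ.comp hφ.tendsto_atTop
  have hylim : ∀ l, Tendsto (y l ∘ φ) atTop (𝓝 a) := by
    intro l
    rw [tendsto_pi_nhds] at hlim ⊢
    intro j
    have h0 : Tendsto (fun n => (y l ∘ φ) n j - (x ∘ φ) n j) atTop (𝓝 0) := by
      apply squeeze_zero_norm _ hδφ
      intro n
      obtain ⟨h1, h2⟩ := hclose (φ n) l j
      have h1' : (k (φ n) l j : ℝ) ≤ k0 (φ n) j + Fintype.card I := by exact_mod_cast h1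
      have h2' : (k0 (φ n) j : ℝ) ≤ k (φ n) l j + Fintype.card I := by exact_mod_cast h2
      simp only [Function.comp, x, y]
      rw [← sub_div, Real.norm_eq_abs, abs_div, abs_of_pos (by positivity : (0:ℝ) < (φ n : ℝ) + 1)]
      gcongr
      rw [abs_le]
      constructor <;> linarith
    have := h0.add (hlim j)
    simpa using this
  refine ⟨a, ha, fun i => ?_⟩
  have hfy : Tendsto (fun n => f ((y i ∘ φ) n)) atTop (𝓝 (f a)) := by
    apply (hf a ha).tendsto.comp
    exact tendsto_nhdsWithin_iff.2 ⟨hylim i, Eventually.of_forall fun n => hy i _⟩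
  have h1 := (tendsto_pi_nhds.1 (hylim i) i).sub hδφ
  have h2 := tendsto_pi_nhds.1 hfy i
  rw [sub_zero] at h1
  refine le_of_tendsto_of_tendsto' h1 h2 fun n => ?_
  simp only [Function.comp]
  have hpos : (0 : ℝ) ≤ (Fintype.card I : ℝ) / ((φ n : ℝ) + 1) := by positivity
  rcases hor (φ n) i with h | h
  · have := hc (φ n) (k (φ n) i) (hk (φ n) i)
    rw [h] at this
    simp only [y]
    linarith
  · have h3 := (hmaps (hy i (φ n))).1 i
    have h4 : y i (φ n) i ≤ (Fintype.card I : ℝ) / ((φ n : ℝ) + 1) := by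
      simp only [y]
      gcongr
    linarith

open Filter Topology in
theorem schauder_ball {X : Type*} [NormedAddCommGroup X] [NormedSpace ℝ X]
    (B K : Set X) (hB : Convex ℝ B) (hBc : IsClosed B) (hBne : B.Nonempty)
    (F : X → X) (hF : Continuous F) (hK : IsCompact K) (hKB : K ⊆ B) (hFK : Set.MapsTo F B K) :
    ∃ x ∈ B, F x = x := by
  classical
  have happ : ∀ ε : ℝ, 0 < ε → ∃ x ∈ B, ‖x - F x‖ ≤ ε := by
    intro ε hε
    obtain ⟨t, htK, htfin, hcov⟩ := hK.finite_cover_balls hε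
    obtain ⟨b, hb⟩ := hBne
    have hex : ∀ z ∈ K, ∃ y ∈ t, dist z y < ε := by
      intro z hz
      simpa using hcov hz
    haveI : Fintype t := htfin.fintype
    obtain ⟨y0, hy0, -⟩ := hex _ (hFK hb)
    haveI : Nonempty t := ⟨⟨y0, hy0⟩⟩
    let w : t → X → ℝ := fun y z => max 0 (ε - dist z y)
    have hw0 : ∀ y z, 0 ≤ w y z := fun y z => le_max_left _ _
    have hwc : ∀ y, Continuous (w y) := fun y => by
      simp only [w]; fun_prop
    have hWpos : ∀ z ∈ K, 0 < ∑ y, w y z := by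
      intro z hz
      obtain ⟨y, hy, hd⟩ := hex z hz
      refine Finset.sum_pos' (fun y _ => hw0 y z) ⟨⟨y, hy⟩, Finset.mem_univ _, ?_⟩
      exact lt_max_of_lt_right (by simpa using hd)
    let L : (t → ℝ) → X := fun l => ∑ y, l y • (y : X)
    have hLc : Continuous L := by simp only [L]; fun_prop
    have hLB : ∀ l ∈ stdSimplex ℝ t, L l ∈ B := fun l hl =>
      hB.sum_mem (fun i _ => hl.1 i) hl.2 (fun i _ => hKB (htK i.2))
    let g : (t → ℝ) → (t → ℝ) := fun l y => w y (F (L l)) / ∑ y', w y' (F (L l))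
    obtain ⟨l, hl, hgl⟩ := brouwer_simplex g
      (by
        apply continuousOn_pi.2
        intro y
        apply ContinuousOn.div
        · exact ((hwc y).comp (hF.comp hLc)).continuousOn
        · exact (continuous_finsetSum _ fun y _ => (hwc y).comp (hF.comp hLc)).continuousOn
        · intro l hl
          exact (hWpos _ (hFK (hLB l hl))).ne')
      (by
        intro l hl
        have hp := hWpos _ (hFK (hLB l hl))
        refine ⟨fun y => div_nonneg (hw0 _ _) hp.le, ?_⟩
        simp only [g]
        rw [← Finset.sum_div, div_self hp.ne'])
    refine ⟨L l, hLB l hl, ?_⟩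
    have h1 : L l - F (L l) = ∑ y, l y • ((y : X) - F (L l)) := by
      simp only [smul_sub, Finset.sum_sub_distrib, ← Finset.sum_smul]
      rw [hl.2, one_smul]
    rw [h1]
    calc ‖∑ y, l y • ((y : X) - F (L l))‖ ≤ ∑ y, ‖l y • ((y : X) - F (L l))‖ := norm_sum_le _ _
      _ ≤ ∑ y, l y * ε := by
        apply Finset.sum_le_sum
        intro y _
        rw [norm_smul, Real.norm_of_nonneg (hl.1 y)]
        by_cases hd : dist (F (L l)) y ≤ ε
        · rw [dist_comm, dist_eq_norm] at hd
          exact mul_le_mul_of_nonneg_left hd (hl.1 y)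
        · have hwz : w y (F (L l)) = 0 := max_eq_left (by linarith)
          have : l y = 0 := by
            rw [← hgl]
            simp only [g]
            rw [hwz, zero_div]
          rw [this]; simp
      _ = ε := by rw [← Finset.sum_mul, hl.2, one_mul]
  choose x hxB hx using fun n : ℕ => happ (1 / ((n : ℝ) + 1)) (by positivity)
  obtain ⟨a, haK, φ, hφ, hlim⟩ := hK.tendsto_subseq fun n => hFK (hxB n)
  have h0 : Tendsto (fun n => x (φ n) - F (x (φ n))) atTop (𝓝 0) :=
    squeeze_zero_norm (fun n => hx (φ n))
      (tendsto_one_div_add_atTop_nhds_zero_nat.comp hφ.tendsto_atTop)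
  have h1 : Tendsto (fun n => x (φ n)) atTop (𝓝 a) := by
    have := h0.add hlim
    simpa using this
  refine ⟨a, hKB haK, ?_⟩
  exact tendsto_nhds_unique ((hF.tendsto a).comp h1) hlim

theorem stmt_13 (X : Type*) [NormedAddCommGroup X] [NormedSpace ℝ X] [CompleteSpace X]
    (T : X → X) (hcont : Continuous T)
    (hcompact : ∀ s : Set X, Bornology.IsBounded s → IsCompact (closure (T '' s)))
    (hbound : Bornology.IsBounded {x : X | ∃ ρ ∈ Set.Icc (0 : ℝ) 1, x = ρ • T x}) :
    ∃ x : X, T x = x := by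
  obtain ⟨R, hR, hsol⟩ := hbound.exists_pos_norm_lt
  let r : X → X := fun z => (R / max R ‖z‖) • z
  have hmax : ∀ z : X, 0 < max R ‖z‖ := fun z => lt_max_of_lt_left hR
  have hr : Continuous r := by
    refine Continuous.smul (Continuous.div continuous_const (by fun_prop) ?_) continuous_id
    exact fun z => (hmax z).ne'
  have hrB : ∀ z, r z ∈ Metric.closedBall (0 : X) R := by
    intro z
    rw [mem_closedBall_zero_iff, norm_smul, Real.norm_of_nonneg (div_nonneg hR.le (hmax z).le),
      div_mul_eq_mul_div, div_le_iff₀ (hmax z)]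
    exact mul_le_mul_of_nonneg_left (le_max_right _ _) hR.le
  obtain ⟨x, hxB, hx⟩ := schauder_ball (Metric.closedBall (0 : X) R)
    (r '' closure (T '' Metric.closedBall (0 : X) R)) (convex_closedBall _ _)
    Metric.isClosed_closedBall ⟨0, by simp [hR.le]⟩ (r ∘ T) (hr.comp hcont)
    ((hcompact _ Metric.isBounded_closedBall).image hr)
    (by rintro _ ⟨z, -, rfl⟩; exact hrB z)
    (fun x hx => ⟨T x, subset_closure ⟨x, hx, rfl⟩, rfl⟩)
  have hx' : x = (R / max R ‖T x‖) • T x := hx.symm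
  have hlt : ‖x‖ < R := hsol x ⟨R / max R ‖T x‖,
    ⟨div_nonneg hR.le (hmax _).le, (div_le_one (hmax _)).2 (le_max_left _ _)⟩, hx'⟩
  refine ⟨x, ?_⟩
  by_cases hT : ‖T x‖ ≤ R
  · rw [max_eq_left hT, div_self hR.ne', one_smul] at hx'
    exact hx'.symm
  · exfalso
    push Not at hT
    have hn : ‖x‖ = R := by
      have h0 : 0 < ‖T x‖ := hR.trans hT
      rw [max_eq_right hT.le] at hx'
      have := congrArg norm hx'
      rw [norm_smul, Real.norm_of_nonneg (div_nonneg hR.le h0.le), div_mul_cancel₀ _ h0.ne'] at this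
      exact this
    exact hlt.ne hn
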